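/- Let M be any trellis automaton over Σ = {a, b} whose state set contains the eleven states {?, 0, 1, 0↗, 1↗, 0↖, 1↖, 0⁰, 0¹, 1⁰, 1¹}, whose initial function satisfies I(a) = 0↗ and I(b) = 0↖, and whose transition function agrees with the 50 listed transitions. Let w bⁿ (n ≥ 2) be the description of a sequential NOR circuit with gate values x₁, …, xₙ. Then for every i with 1 ≤ i ≤ n, the state Δ(w bⁱ) belongs to {xᵢ, xᵢ⁰, xᵢ¹} (the plain state or a memory state whose value component is xᵢ); moreover Δ(w bⁿ) is exactly the plain state xₙ. -/

import Mathlib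

/-- The two-letter alphabet Σ = {a, b}. -/
inductive Letter : Type
  | a
  | b
deriving DecidableEq

/-- The eleven states: `q` is the question mark `?`; `v0`, `v1` are the plain
states 0, 1; `r0`, `r1` are 0↗, 1↗; `l0`, `l1` are 0↖, 1↖; and `m00`, `m01`,
`m10`, `m11` are the memory states 0⁰, 0¹, 1⁰, 1¹ (value component first). -/
inductive St : Type
  | q
  | v0 | v1
  | r0 | r1
  | l0 | l1
  | m00 | m01 | m10 | m11
deriving DecidableEq

/-- The plain state with value component `x`. -/
def St.plain : Bool → St
  | false => .v0
  | true  => .v1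

/-- The state x↗ with value component `x`. -/
def St.up : Bool → St
  | false => .r0
  | true  => .r1

/-- The state x↖ with value component `x`. -/
def St.dn : Bool → St
  | false => .l0
  | true  => .l1

/-- The memory state x^y with value component `x` and memory component `y`. -/
def St.mem : Bool → Bool → St
  | false, false => .m00
  | false, true  => .m01
  | true,  false => .m10
  | true,  true  => .m11

/-- The 50 listed transitions, as a partial function: `delta50 s t = some r`
means the transition (s, t) ↦ r is listed; `none` means δ may be arbitrary. -/
def delta50 : St → St → Option St
  | .q,   .q   => some .q
  | .v0,  .q   => some .q
  | .v0,  .v0  => some .v0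
  | .v0,  .v1  => some .v1
  | .v0,  .r0  => some .v0
  | .v0,  .r1  => some .v1
  | .v0,  .l0  => some .m00
  | .v0,  .l1  => some .m11
  | .v0,  .m00 => some .v0
  | .v0,  .m01 => some .v0
  | .v0,  .m10 => some .v1
  | .v0,  .m11 => some .v1
  | .v1,  .q   => some .q
  | .v1,  .v0  => some .v0
  | .v1,  .r0  => some .v0
  | .v1,  .l0  => some .m00
  | .v1,  .m00 => some .v0
  | .v1,  .m01 => some .v0
  | .r0,  .q   => some .l1
  | .r0,  .v0  => some .l0
  | .r0,  .v1  => some .l1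
  | .r0,  .r0  => some .r0
  | .r0,  .r1  => some .r1
  | .r0,  .l0  => some .r0
  | .r0,  .l1  => some .r1
  | .r0,  .m11 => some .l1
  | .r1,  .v0  => some .l0
  | .r1,  .r0  => some .r0
  | .r1,  .l0  => some .r0
  | .l0,  .q   => some .q
  | .l0,  .v0  => some .v0
  | .l0,  .v1  => some .v1
  | .l0,  .r0  => some .l0
  | .l0,  .r1  => some .v1
  | .l0,  .l0  => some .q
  | .l0,  .l1  => some .m11
  | .l1,  .q   => some .q
  | .l1,  .v0  => some .v0
  | .l1,  .m00 => some .v0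
  | .l1,  .m01 => some .v0
  | .m00, .q   => some .v1
  | .m00, .v0  => some .m00
  | .m00, .v1  => some .m10
  | .m01, .q   => some .v0
  | .m01, .v0  => some .m01
  | .m01, .v1  => some .m11
  | .m10, .q   => some .v0
  | .m10, .v0  => some .m00
  | .m11, .q   => some .v0
  | .m11, .v0  => some .m01
  | _,    _    => none

/-- The result function Δ of a trellis automaton with initial function `I` and
transition function `d`, defined on nonempty strings by Δ(c) = I(c) and
Δ(c w d) = δ(Δ(c w), Δ(w d)); the value on the empty string is junk. -/
def Delta {Q : Type*} (I : Letter → Q) (d : Q → Q → Q) : List Letter → Q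
  | [] => I Letter.a
  | [c] => I c
  | c :: x :: xs => d (Delta I d (c :: (x :: xs).dropLast)) (Delta I d (x :: xs))
termination_by l => l.length
decreasing_by
  · simp [List.length_dropLast]
  · simp

/-- The description `w` (without the work-space suffix bⁿ) of the sequential
NOR circuit with `n` gates and indices `j`:
`w = b a^{jₙ} b a^{jₙ₋₁} ⋯ b a^{j₃} b a b`. -/
def descW (j : ℕ → ℕ) : ℕ → List Letter
  | 0 => []
  | 1 => []
  | 2 => [Letter.b, Letter.a, Letter.b]
  | (m+3) => (Letter.b :: List.replicate (j (m+3)) Letter.a) ++ descW j (m+2)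

/-- The state assigned to a letter by the initial function. -/
def Letter.st : Letter → St
  | .a => .r0
  | .b => .l0

/-- The states along the row of `aᵏ W`, where `W` is the description of the first `m - 1` gates
of a circuit with gate values `x`, as a function of the number of trailing `b`s. -/
def pointerRow (x : ℕ → Bool) (m k i : ℕ) : St :=
  if i = 0 then .r0 else if i < k then .up (x i) else if i = k then .dn (x i)
  else if i < m then .plain (x i) else .q

/-- The states along the row of the description of the first `m` gates of a circuit with gate
values `x` whose `m`-th gate has index `k`, as a function of the number of trailing `b`s. -/
def gateRow (x : ℕ → Bool) (m k i : ℕ) : St :=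
  if i = 0 then .l0 else if i < k then .plain (x i) else if i < m then .mem (x i) (x k)
  else if i = m then .plain (x i) else .q

theorem delta50_pointerRow_one {x : ℕ → Bool} {m k : ℕ} (hx1 : x 1 = true) (hk : 1 ≤ k) (hkm : k < m)
    (hx : ∀ i, 1 ≤ i → i < m → (x i && x (i + 1)) = false) (i : ℕ) :
    delta50 (pointerRow x (m + 1) 1 i) (gateRow x m k (i + 1)) =
      some (pointerRow x (m + 1) 1 (i + 1)) := by
  have h := hx i
  unfold pointerRow gateRow
  rcases Nat.eq_zero_or_pos i with rfl | hi
  · split_ifs <;> first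
      | contradiction
      | omega
      | (simp only [Nat.zero_add, hx1]; rfl)
      | (have heq : k = 1 := by omega
         subst heq
         simp only [Nat.zero_add, hx1]; rfl)
  · split_ifs <;> first
      | contradiction
      | omega
      | (specialize h (by omega) (by omega)
         revert h
         cases x i <;> cases x (i + 1) <;> cases x k <;> decide)
      | (have heq : i = 1 := by omega
         subst heq
         specialize h (by omega) (by omega)
         rw [hx1] at h ⊢
         revert h
         cases x (1 + 1) <;> cases x k <;> decide)
      | (cases x i <;> rfl)

theorem delta50_pointerRow_succ {x : ℕ → Bool} {m k : ℕ} (hk : 1 ≤ k) (hkm : k + 1 < m)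
    (hx : ∀ i, 1 ≤ i → i + 1 < m → (x i && x (i + 1)) = false) (i : ℕ) :
    delta50 (pointerRow x m (k + 1) i) (pointerRow x m k (i + 1)) =
      some (pointerRow x m (k + 1) (i + 1)) := by
  have h := hx i
  unfold pointerRow
  split_ifs <;> first
    | contradiction
    | omega
    | (specialize h (by omega) (by omega)
       revert h
       cases x i <;> cases x (i + 1) <;> decide)
    | (cases x i <;> cases x (i + 1) <;> rfl)

theorem delta50_gateRow {x : ℕ → Bool} {m k : ℕ} (hx1 : x 1 = true) (hk : 1 ≤ k) (hkm : k < m)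
    (hx : ∀ i, 1 ≤ i → i + 1 < m → (x i && x (i + 1)) = false)
    (hxm : x m = !(x (m - 1) || x k)) (i : ℕ) :
    delta50 (gateRow x m k i) (pointerRow x m k (i + 1)) = some (gateRow x m k (i + 1)) := by
  have h := hx i
  unfold pointerRow gateRow
  rcases Nat.eq_zero_or_pos i with rfl | hi
  · split_ifs <;> first
      | contradiction
      | omega
      | (simp only [Nat.zero_add, hx1]; rfl)
      | (have heq : k = 1 := by omega
         subst heq
         simp only [Nat.zero_add, hx1]; rfl)
  · split_ifs <;> first
      | contradiction
      | omega
      | (specialize h (by omega) (by omega)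
         revert h
         cases x i <;> cases x (i + 1) <;> cases x k <;> decide)
      | (have heq : k = i + 1 := by omega
         subst heq
         specialize h (by omega) (by omega)
         revert h
         cases x i <;> cases x (i + 1) <;> decide)
      | (have heq : m = i + 1 := by omega
         subst heq
         rw [Nat.add_sub_cancel] at hxm
         rw [hxm]
         cases x i <;> cases x k <;> rfl)
      | (cases x i <;> rfl)

section Rows

variable {Q : Type*} {I : Letter → Q} {δ : Q → Q → Q} {e : St → Q}

theorem Delta_cons_append_replicate_succ (c : Letter) (u : List Letter) (i : ℕ) :
    Delta I δ (c :: u ++ List.replicate (i + 1) Letter.b) =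
      δ (Delta I δ (c :: u ++ List.replicate i Letter.b))
        (Delta I δ (u ++ List.replicate (i + 1) Letter.b)) := by
  have hdrop : (u ++ List.replicate (i + 1) Letter.b).dropLast =
      u ++ List.replicate i Letter.b := by
    rw [List.replicate_succ', ← List.append_assoc, List.dropLast_concat]
  obtain ⟨y, ys, hy⟩ : ∃ y ys, u ++ List.replicate (i + 1) Letter.b = y :: ys :=
    List.exists_cons_of_ne_nil (by simp)
  rw [List.cons_append, List.cons_append, ← hdrop, hy, Delta]

theorem Delta_eq_st_of_isChain (hI : ∀ c, I c = e c.st)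
    (hδ : ∀ s t r : St, delta50 s t = some r → δ (e s) (e t) = e r) :
    ∀ (u : List Letter) (c : Letter),
      (c :: u).IsChain (fun s t => ¬(s = .b ∧ t = .b)) → Delta I δ (c :: u) = e c.st
  | [], c, _ => by rw [Delta, hI]
  | y :: ys, c, h => by
    have h₁ : Delta I δ (c :: (y :: ys).dropLast) = e c.st := by
      refine Delta_eq_st_of_isChain hI hδ _ c ?_
      exact List.IsChain.dropLast h
    have h₂ := Delta_eq_st_of_isChain hI hδ ys y h.tail
    rw [Delta, h₁, h₂]
    apply hδ
    have hcy := (List.isChain_cons_cons.1 h).1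
    cases c <;> cases y <;> simp_all [Letter.st, delta50]
termination_by u => u.length
decreasing_by
  · simp
  · simp

theorem Delta_row (hI : ∀ c, I c = e c.st)
    (hδ : ∀ s t r : St, delta50 s t = some r → δ (e s) (e t) = e r)
    {c : Letter} {u : List Letter} (hu : (c :: u).IsChain (fun s t => ¬(s = .b ∧ t = .b)))
    {r s : ℕ → St} (hs : ∀ i, Delta I δ (u ++ List.replicate (i + 1) Letter.b) = e (s (i + 1)))
    (hr₀ : r 0 = c.st) (hr : ∀ i, delta50 (r i) (s (i + 1)) = some (r (i + 1))) (i : ℕ) :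
    Delta I δ (c :: u ++ List.replicate i Letter.b) = e (r i) := by
  induction i with
  | zero => simpa [hr₀] using Delta_eq_st_of_isChain hI hδ u c hu
  | succ i ih => rw [Delta_cons_append_replicate_succ, ih, hs, hδ _ _ _ (hr i)]

end Rows

theorem isChain_replicate_a_append {u : List Letter}
    (hu : u.IsChain (fun s t => ¬(s = .b ∧ t = .b))) (k : ℕ) :
    (List.replicate k Letter.a ++ u).IsChain (fun s t => ¬(s = .b ∧ t = .b)) := by
  induction k with
  | zero => exact hu
  | succ k ih =>
    rw [List.replicate_succ, List.cons_append]
    exact ih.cons (by simp)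

theorem isChain_b_cons_replicate_a_append {u : List Letter}
    (hu : u.IsChain (fun s t => ¬(s = .b ∧ t = .b))) {k : ℕ} (hk : 1 ≤ k) :
    (Letter.b :: (List.replicate k Letter.a ++ u)).IsChain (fun s t => ¬(s = .b ∧ t = .b)) := by
  obtain ⟨k, rfl⟩ := Nat.exists_eq_add_of_le' hk
  exact (isChain_replicate_a_append hu (k + 1)).cons (by simp [List.replicate_succ])

theorem Delta_descW {Q : Type*} {I : Letter → Q} {δ : Q → Q → Q} {e : St → Q}
    (hI : ∀ c, I c = e c.st)
    (hδ : ∀ s t r : St, delta50 s t = some r → δ (e s) (e t) = e r)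
    {n : ℕ} {j : ℕ → ℕ} (hj : ∀ i, 3 ≤ i → i ≤ n → 1 ≤ j i ∧ j i < i)
    {x : ℕ → Bool} (hx1 : x 1 = true) (hx2 : x 2 = false)
    (hx : ∀ i, 3 ≤ i → i ≤ n → x i = !(x (i - 1) || x (j i)))
    (m : ℕ) (hm : 2 ≤ m) (hmn : m ≤ n) :
    (descW j m).IsChain (fun s t => ¬(s = .b ∧ t = .b)) ∧
      ∃ k, 1 ≤ k ∧ k < m ∧
        ∀ i, Delta I δ (descW j m ++ List.replicate i Letter.b) = e (gateRow x m k i) := by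
  have hxx : ∀ i, 1 ≤ i → i + 1 ≤ n → (x i && x (i + 1)) = false := by
    intro i hi hin
    obtain rfl | hi := hi.eq_or_lt
    · simp [hx2]
    · rw [hx (i + 1) (by omega) hin, Nat.add_sub_cancel]
      cases x i <;> simp
  induction m, hm using Nat.le_induction with
  | base =>
    have hchain : (descW j 2).IsChain (fun s t => ¬(s = .b ∧ t = .b)) := by simp [descW]
    have hq : ∀ i, Delta I δ ([] ++ List.replicate (i + 1) Letter.b) =
        e (if i = 0 then St.l0 else St.q) := by
      intro i
      induction i with
      | zero => simp [Delta, hI, Letter.st]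
      | succ i ih =>
        have h := Delta_cons_append_replicate_succ (I := I) (δ := δ) Letter.b [] i
        have hb : Letter.b :: [] ++ List.replicate (i + 1) Letter.b =
          [] ++ List.replicate (i + 1 + 1) Letter.b := by simp [List.replicate_succ]
        have hb' : Letter.b :: [] ++ List.replicate i Letter.b =
          [] ++ List.replicate (i + 1) Letter.b := by simp [List.replicate_succ]
        rw [hb, hb', ih] at h
        rw [h]
        apply hδ
        split_ifs <;> first | contradiction | omega | rfl
    have hb : ∀ i, Delta I δ ([Letter.b] ++ List.replicate (i + 1) Letter.b) = e St.q := by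
      intro i
      simpa [List.replicate_succ] using hq (i + 1)
    have ha : ∀ i, Delta I δ ([Letter.a, Letter.b] ++ List.replicate i Letter.b) =
        e (pointerRow x 2 1 i) := by
      refine Delta_row hI hδ (by simp) (s := fun _ => St.q) hb rfl fun i => ?_
      unfold pointerRow
      split_ifs <;> first
        | contradiction
        | omega
        | (subst_vars; simp only [Nat.zero_add, hx1]; rfl)
        | (cases x i <;> rfl)
    refine ⟨hchain, 1, le_rfl, by omega, ?_⟩
    exact Delta_row hI hδ hchain (fun i => ha (i + 1)) rfl
      (delta50_gateRow hx1 le_rfl (by omega) (fun i hi hi' => hxx i hi (by omega))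
        (by simp [hx1, hx2]))
  | succ m hm ih =>
    obtain ⟨hchain, k, hk, hkm, hrow⟩ := ih (by omega)
    obtain ⟨hj₁, hj₂⟩ := hj (m + 1) (by omega) hmn
    have hdesc : descW j (m + 1) =
        Letter.b :: (List.replicate (j (m + 1)) Letter.a ++ descW j m) := by
      obtain ⟨m, rfl⟩ := Nat.exists_eq_add_of_le' hm
      rw [descW, List.cons_append]
    have hpointer : ∀ l, 1 ≤ l → l < m + 1 → ∀ i,
        Delta I δ (List.replicate l Letter.a ++ descW j m ++ List.replicate i Letter.b) =
          e (pointerRow x (m + 1) l i) := by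
      intro l hl
      induction l, hl using Nat.le_induction with
      | base =>
        intro _
        exact Delta_row hI hδ (isChain_replicate_a_append hchain 1) (fun i => hrow (i + 1)) rfl
          (delta50_pointerRow_one hx1 hk hkm fun i hi hi' => hxx i hi (by omega))
      | succ l hl ihl =>
        intro hlm
        exact Delta_row hI hδ (isChain_replicate_a_append hchain (l + 1))
          (fun i => ihl (by omega) (i + 1)) rfl
          (delta50_pointerRow_succ hl hlm fun i hi hi' => hxx i hi (by omega))
    have hchain' := isChain_b_cons_replicate_a_append hchain hj₁
    rw [hdesc]
    refine ⟨hchain', j (m + 1), hj₁, hj₂, ?_⟩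
    exact Delta_row hI hδ hchain' (fun i => hpointer _ hj₁ hj₂ (i + 1)) rfl
      (delta50_gateRow hx1 hj₁ hj₂ (fun i hi hi' => hxx i hi (by omega))
        (hx (m + 1) (by omega) hmn))

/-- Under the same assumptions on the automaton, for every
sequential NOR circuit with n ≥ 2 gates, gate values x₁, …, xₙ and description
w bⁿ: for all 1 ≤ i ≤ n, Δ(w bⁱ) ∈ {xᵢ, xᵢ⁰, xᵢ¹}, and Δ(w bⁿ) is the plain
state xₙ. -/
theorem statement1 {Q : Type*} (I : Letter → Q) (δ : Q → Q → Q)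
    (e : St → Q) (he : Function.Injective e)
    (hIa : I Letter.a = e St.r0) (hIb : I Letter.b = e St.l0)
    (hδ : ∀ s t r : St, delta50 s t = some r → δ (e s) (e t) = e r)
    (n : ℕ) (hn : 2 ≤ n) (j : ℕ → ℕ)
    (hj : ∀ i, 3 ≤ i → i ≤ n → 1 ≤ j i ∧ j i < i)
    (x : ℕ → Bool) (hx1 : x 1 = true) (hx2 : x 2 = false)
    (hx : ∀ i, 3 ≤ i → i ≤ n → x i = !(x (i - 1) || x (j i))) :
    (∀ i, 1 ≤ i → i ≤ n →
      Delta I δ (descW j n ++ List.replicate i Letter.b) ∈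
        ({e (St.plain (x i)), e (St.mem (x i) false), e (St.mem (x i) true)} :
          Set Q)) ∧
    Delta I δ (descW j n ++ List.replicate n Letter.b) = e (St.plain (x n)) := by
  obtain ⟨-, k, hk, hkn, hrow⟩ :=
    Delta_descW (fun c => by cases c <;> assumption) hδ hj hx1 hx2 hx n hn le_rfl
  refine ⟨fun i hi hin => ?_, ?_⟩
  · rw [hrow, gateRow]
    split_ifs
    · omega
    · simp
    · cases x k <;> simp
    · simp
    · omega
  · rw [hrow, gateRow, if_neg (by omega), if_neg (by omega), if_neg (by omega), if_pos rfl]
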